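/- Define t: ℕ → ℕ by t(0) := 1 and t(k+1) := t(k)·2^{t(k)}. For every natural number k, there exists an unsatisfiable linear k-CNF formula with at most t(k) clauses. -/

import Mathlib

/-- A clause: a finite set of literals, where a literal is a pair of a variable
and a sign (`true` = positive occurrence, `false` = negated occurrence). -/
abbrev Clause (V : Type) : Type := Finset (V × Bool)

/-- A CNF formula: a finite set of clauses. -/
abbrev CNF (V : Type) : Type := Finset (Finset (V × Bool))

/-- The set of variables occurring (possibly negated) in a clause. -/
def vbl {V : Type} [DecidableEq V] (C : Clause V) : Finset V := C.image Prod.fst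

/-- A clause is proper if it does not contain both a variable and its negation. -/
def ProperClause {V : Type} (C : Clause V) : Prop :=
  ∀ x : V, ¬ ((x, true) ∈ C ∧ (x, false) ∈ C)

/-- The literal `(x, b)` evaluates to true under `α` iff `α x = b`;
an assignment satisfies a clause if some literal evaluates to true. -/
def SatClause {V : Type} (α : V → Bool) (C : Clause V) : Prop :=
  ∃ l ∈ C, α l.1 = l.2

instance {V : Type} [DecidableEq V] (α : V → Bool) (C : Clause V) :
    Decidable (SatClause α C) := by unfold SatClause; infer_instance

/-- An assignment satisfies a formula if it satisfies every clause. -/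
def Satisfies {V : Type} (α : V → Bool) (F : CNF V) : Prop :=
  ∀ C ∈ F, SatClause α C

/-- A formula is unsatisfiable if no assignment satisfies it. -/
def Unsat {V : Type} (F : CNF V) : Prop := ∀ α : V → Bool, ¬ Satisfies α F

/-- A `k`-CNF: every clause is proper and has exactly `k` literals. -/
def IsKCNF {V : Type} (k : ℕ) (F : CNF V) : Prop :=
  ∀ C ∈ F, ProperClause C ∧ C.card = k

/-- A CNF is linear if any two distinct clauses share at most one variable. -/
def LinearCNF {V : Type} [DecidableEq V] (F : CNF V) : Prop :=
  ∀ C ∈ F, ∀ D ∈ F, C ≠ D → (vbl C ∩ vbl D).card ≤ 1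

/-- The tower-like size bound: `t 0 = 1` and `t (k+1) = t k · 2 ^ (t k)`. -/
def t : ℕ → ℕ
  | 0 => 1
  | k + 1 => t k * 2 ^ (t k)

section Extension

variable {V W : Type} [DecidableEq V] [DecidableEq W]

/-- The copy of the clause `C` on the variables `e (inr (x, S))`, extended by a literal of the
variable `e (inl C)` whose sign records whether `C ∈ S`. -/
def extendClause (e : Clause V ⊕ (V × CNF V) → W) (S : CNF V) (C : Clause V) : Clause W :=
  insert (e (Sum.inl C), decide (C ∈ S)) (C.image fun l => (e (Sum.inr (l.1, S)), l.2))

/-- One disjoint copy of `F` for each `S ⊆ F`, with every clause extended by a fresh literal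
according to the sign pattern `S`. -/
def extendCNF (e : Clause V ⊕ (V × CNF V) → W) (F : CNF V) : CNF W :=
  (F ×ˢ F.powerset).image fun p => extendClause e p.2 p.1

theorem mem_extendCNF {e : Clause V ⊕ (V × CNF V) → W} {F : CNF V} {A : Clause W} :
    A ∈ extendCNF e F ↔ ∃ C ∈ F, ∃ S ⊆ F, extendClause e S C = A := by
  simp [extendCNF, and_assoc]

theorem vbl_extendClause (e : Clause V ⊕ (V × CNF V) → W) (S : CNF V) (C : Clause V) :
    vbl (extendClause e S C) =
      insert (e (Sum.inl C)) ((vbl C).image fun x => e (Sum.inr (x, S))) := by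
  simp [vbl, extendClause, Finset.image_insert, Finset.image_image, Function.comp_def]

theorem card_extendCNF_le (e : Clause V ⊕ (V × CNF V) → W) (F : CNF V) :
    (extendCNF e F).card ≤ F.card * 2 ^ F.card :=
  Finset.card_image_le.trans (by rw [Finset.card_product, Finset.card_powerset])

theorem IsKCNF.extendCNF {e : Clause V ⊕ (V × CNF V) → W} (he : Function.Injective e)
    {k : ℕ} {F : CNF V} (hF : IsKCNF k F) : IsKCNF (k + 1) (extendCNF e F) := by
  intro A hA
  obtain ⟨C, hC, S, -, rfl⟩ := mem_extendCNF.1 hA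
  obtain ⟨hproper, hcard⟩ := hF C hC
  constructor
  · rintro y ⟨htrue, hfalse⟩
    simp only [extendClause, Finset.mem_insert, Finset.mem_image, Prod.mk.injEq] at htrue hfalse
    rcases htrue with ⟨rfl, h⟩ | ⟨⟨x, b⟩, hx, rfl, rfl⟩
    · rcases hfalse with ⟨-, h'⟩ | ⟨l, -, h', -⟩
      · exact Bool.noConfusion (h.trans h'.symm)
      · exact absurd (he h') (by simp)
    · rcases hfalse with ⟨h', -⟩ | ⟨⟨z, c⟩, hz, h', rfl⟩
      · exact absurd (he h') (by simp)
      · obtain rfl : z = x := by simpa using he h'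
        exact hproper z ⟨hx, hz⟩
  · rw [extendClause, Finset.card_insert_of_notMem, Finset.card_image_of_injective, hcard]
    · rintro ⟨x, b⟩ ⟨z, c⟩ h
      simpa [he.eq_iff] using h
    · simp [he.eq_iff]

theorem LinearCNF.extendCNF {e : Clause V ⊕ (V × CNF V) → W} (he : Function.Injective e)
    {F : CNF V} (hF : LinearCNF F) : LinearCNF (extendCNF e F) := by
  intro A hA B hB hAB
  obtain ⟨C, hC, S, -, rfl⟩ := mem_extendCNF.1 hA
  obtain ⟨D, hD, T, -, rfl⟩ := mem_extendCNF.1 hB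
  rw [vbl_extendClause, vbl_extendClause]
  by_cases hST : S = T
  · subst hST
    have hCD : C ≠ D := fun h => hAB (h ▸ rfl)
    refine le_trans (Finset.card_le_card ?_)
      ((Finset.card_image_le (f := fun x => e (Sum.inr (x, S)))).trans (hF C hC D hD hCD))
    intro y
    simp only [Finset.mem_inter, Finset.mem_insert, Finset.mem_image]
    rintro ⟨rfl | ⟨x, hx, rfl⟩, h | ⟨z, hz, h⟩⟩ <;> simp_all [he.eq_iff]
  · refine le_trans (Finset.card_le_card (t := {e (Sum.inl C)}) ?_) (by simp)
    intro y
    simp only [Finset.mem_inter, Finset.mem_insert, Finset.mem_image, Finset.mem_singleton]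
    rintro ⟨rfl | ⟨x, hx, rfl⟩, h | ⟨z, hz, h⟩⟩ <;> simp_all [he.eq_iff]

theorem Unsat.extendCNF (e : Clause V ⊕ (V × CNF V) → W) {F : CNF V} (hF : Unsat F) :
    Unsat (extendCNF e F) := by
  intro α hα
  let S : CNF V := F.filter fun C => α (e (Sum.inl C)) = false
  refine hF (fun x => α (e (Sum.inr (x, S)))) fun C hC => ?_
  obtain ⟨l, hl, hsat⟩ := hα _ (mem_extendCNF.2 ⟨C, hC, S, Finset.filter_subset _ _, rfl⟩)
  rcases Finset.mem_insert.1 hl with rfl | hl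
  · simp [S, hC] at hsat
  · obtain ⟨m, hm, rfl⟩ := Finset.mem_image.1 hl
    exact ⟨m, hm, hsat⟩

end Extension

/-- For every natural number `k`, there exists an unsatisfiable linear
`k`-CNF formula with at most `t k` clauses. -/
theorem unsat_linear_kCNF_tower_bound (k : ℕ) :
    ∃ F : CNF ℕ, IsKCNF k F ∧ LinearCNF F ∧ Unsat F ∧ F.card ≤ t k := by
  induction k with
  | zero =>
    refine ⟨{∅}, ?_, ?_, ?_, ?_⟩ <;>
      simp [IsKCNF, ProperClause, LinearCNF, Unsat, Satisfies, SatClause, t]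
  | succ k ih =>
    obtain ⟨F, hk, hlin, hunsat, hcard⟩ := ih
    obtain ⟨e, he⟩ := exists_injective_nat (Clause ℕ ⊕ (ℕ × CNF ℕ))
    refine ⟨extendCNF e F, hk.extendCNF he, hlin.extendCNF he, hunsat.extendCNF e, ?_⟩
    calc (extendCNF e F).card ≤ F.card * 2 ^ F.card := card_extendCNF_le e F
      _ ≤ t k * 2 ^ t k := by gcongr; norm_num
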